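/- There is an absolute constant C such that for every function h : [−2,2] → ℝ which is 1/2-Hölder continuous and every t > 0: | ∫_{−2}^{2} φ(t x) h(x) dx − (π/(2t)) h(0) | ≤ C · t^{−3/2} · ‖h‖_{C^{0,1/2}}, where ‖h‖_{C^{0,1/2}} := sup_{x ∈ [−2,2]} |h(x)| + sup_{x ≠ y ∈ [−2,2]} |h(x) − h(y)|/|x − y|^{1/2}. -/

import Mathlib

/-- The Fejér-type kernel `φ(x) = sin²(x/2)/x²`, `φ(0) = 1/4`. -/
noncomputable def fejer (x : ℝ) : ℝ := if x = 0 then 1 / 4 else Real.sin (x / 2) ^ 2 / x ^ 2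

open MeasureTheory Set Filter Topology

lemma fejer_nonneg (x : ℝ) : 0 ≤ fejer x := by
  unfold fejer
  split_ifs <;> positivity

lemma fejer_measurable : Measurable fejer := by
  unfold fejer
  refine Measurable.ite (measurableSet_singleton 0) measurable_const ?_
  fun_prop

lemma fejer_abs (x : ℝ) : fejer |x| = fejer x := by
  rcases abs_choice x with h | h <;> rw [h]
  unfold fejer
  simp [neg_div, Real.sin_neg]

lemma fejer_of_pos {x : ℝ} (hx : 0 < x) : fejer x = 1 / 2 * ((1 - Real.cos x) / x ^ 2) := by
  unfold fejer
  rw [if_neg hx.ne', Real.sin_sq_eq_half_sub]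
  rw [show 2 * (x / 2) = x by ring]
  ring

lemma fejer_bound (x : ℝ) : fejer x * (1 + |x|) ^ 2 ≤ 4 := by
  by_cases h0 : x = 0
  · subst h0; norm_num [fejer]
  have hp : 0 < |x| := abs_pos.mpr h0
  have e : fejer x = Real.sin (x / 2) ^ 2 / |x| ^ 2 := by
    unfold fejer; rw [if_neg h0, sq_abs]
  have h1 : Real.sin (x / 2) ^ 2 ≤ 1 := Real.sin_sq_le_one _
  have h2 : Real.sin (x / 2) ^ 2 ≤ |x| ^ 2 / 4 := by
    have := sq_le_sq' (by linarith [neg_abs_le (Real.sin (x/2)), Real.abs_sin_le_one (x/2), neg_abs_le (Real.sin (x/2)), (Real.abs_sin_le_abs : |Real.sin (x/2)| ≤ |x/2|)] : -|x/2| ≤ Real.sin (x/2)) ((le_abs_self _).trans Real.abs_sin_le_abs)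
    rw [abs_div] at this
    norm_num at this
    nlinarith [sq_abs x]
  rw [e, div_mul_eq_mul_div, div_le_iff₀ (by positivity)]
  rcases le_total |x| 1 with h | h
  · have : (1 + |x|) ^ 2 ≤ 4 := by nlinarith
    nlinarith [mul_le_mul h2 this (by positivity) (by positivity)]
  · have : (1 + |x|) ^ 2 ≤ 4 * |x| ^ 2 := by nlinarith
    nlinarith [mul_le_mul h1 this (by positivity) (by positivity)]

lemma fejer_le (x : ℝ) : fejer x ≤ 4 * (1 + ‖x‖) ^ (-(2 : ℝ)) := by
  rw [Real.norm_eq_abs, Real.rpow_neg (by positivity), ← div_eq_mul_inv, le_div_iff₀ (by positivity)]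
  simpa using fejer_bound x

lemma fejer_integrable : Integrable fejer := by
  have : Integrable (fun x : ℝ => 4 * (1 + ‖x‖) ^ (-(2 : ℝ))) :=
    (integrable_one_add_norm (by norm_num)).const_mul 4
  refine this.mono' fejer_measurable.aestronglyMeasurable (ae_of_all _ fun x => ?_)
  rw [Real.norm_of_nonneg (fejer_nonneg x)]
  exact fejer_le x

lemma fejer_half_integrable : Integrable (fun x => fejer x * |x| ^ ((1 : ℝ) / 2)) := by
  have : Integrable (fun x : ℝ => 4 * (1 + ‖x‖) ^ (-(3 / 2 : ℝ))) :=
    (integrable_one_add_norm (by norm_num)).const_mul 4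
  refine this.mono' (fejer_measurable.mul (by fun_prop)).aestronglyMeasurable
    (ae_of_all _ fun x => ?_)
  have h0 := fejer_nonneg x
  rw [Real.norm_of_nonneg (by positivity)]
  calc fejer x * |x| ^ ((1 : ℝ) / 2)
      ≤ (4 * (1 + ‖x‖) ^ (-(2 : ℝ))) * (1 + ‖x‖) ^ ((1 : ℝ) / 2) := by
        gcongr
        · exact fejer_le x
        · rw [Real.norm_eq_abs]; linarith
    _ = 4 * (1 + ‖x‖) ^ (-(3 / 2 : ℝ)) := by
        rw [mul_assoc, ← Real.rpow_add (by positivity)]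
        norm_num

lemma lint_A {x : ℝ} (hx : 0 < x) :
    ∫⁻ s in Ioi (0 : ℝ), ENNReal.ofReal ((1 - Real.cos x) * (s * Real.exp (-(x * s)))) =
      ENNReal.ofReal ((1 - Real.cos x) / x ^ 2) := by
  have h := Real.integral_rpow_mul_exp_neg_mul_Ioi (a := 2) (r := x) (by norm_num) hx
  norm_num [Real.Gamma_two] at h
  have hi : IntegrableOn (fun s => s * Real.exp (-(x * s))) (Ioi 0) := by
    by_contra hc
    rw [integral_undef hc] at h
    have : 0 < (x ^ 2)⁻¹ := by positivity
    linarith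
  rw [← ofReal_integral_eq_lintegral_ofReal (hi.const_mul _), integral_const_mul, h, div_eq_mul_inv]
  refine (ae_restrict_iff' measurableSet_Ioi).2 (ae_of_all _ fun s hs => ?_)
  have hs' : 0 < s := hs
  have := Real.cos_le_one x
  exact mul_nonneg (by linarith) (by positivity)

lemma lint_B {s : ℝ} (hs : 0 < s) :
    ∫⁻ x in Ioi (0 : ℝ), ENNReal.ofReal ((1 - Real.cos x) * (s * Real.exp (-(x * s)))) =
      ENNReal.ofReal ((1 + s ^ 2)⁻¹) := by
  have hre1 : (-(s : ℂ)).re < 0 := by simpa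
  have hre2 : (-(s : ℂ) + Complex.I).re < 0 := by simpa
  have i1 := integrableOn_exp_mul_complex_Ioi hre1 0
  have i2 := integrableOn_exp_mul_complex_Ioi hre2 0
  have v1 := integral_exp_mul_complex_Ioi hre1 0
  have v2 := integral_exp_mul_complex_Ioi hre2 0
  have key : ∀ x : ℝ, (1 - Real.cos x) * (s * Real.exp (-(x * s))) =
      s * RCLike.re (Complex.exp (-(s : ℂ) * x) - Complex.exp ((-(s : ℂ) + Complex.I) * x)) := by
    intro x
    simp [Complex.exp_re]
    ring_nf
  have i3 := (i1.sub i2)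
  have v3 := integral_sub i1 i2
  simp_rw [key]
  have i4 : IntegrableOn (fun x : ℝ => s * RCLike.re (Complex.exp (-(s : ℂ) * x) -
    Complex.exp ((-(s : ℂ) + Complex.I) * x))) (Ioi 0) := i3.re.const_mul s
  rw [← ofReal_integral_eq_lintegral_ofReal i4]
  · congr 1
    rw [integral_const_mul]
    have := integral_re (𝕜 := ℂ) i3
    simp only [Pi.sub_apply] at this
    rw [this, v3, v1, v2]
    simp [Complex.div_re, Complex.normSq_apply]
    field_simp
    ring
  · refine (ae_restrict_iff' measurableSet_Ioi).2 (ae_of_all _ fun x hx => ?_)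
    have := Real.cos_le_one x
    simp only [← key]
    exact mul_nonneg (by linarith) (by positivity)

lemma lint_cos : ∫⁻ x in Ioi (0 : ℝ), ENNReal.ofReal ((1 - Real.cos x) / x ^ 2) =
    ENNReal.ofReal (Real.pi / 2) := by
  rw [← setLIntegral_congr_fun measurableSet_Ioi (fun x hx => lint_A hx)]
  rw [lintegral_lintegral_swap (by fun_prop)]
  rw [setLIntegral_congr_fun measurableSet_Ioi (fun x hx => lint_B hx)]
  rw [← ofReal_integral_eq_lintegral_ofReal integrable_inv_one_add_sq.integrableOn
    (ae_of_all _ fun x => by positivity), integral_Ioi_inv_one_add_sq]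
  simp

lemma fejer_integral : ∫ x, fejer x = Real.pi / 2 := by
  have h1 : ∫ x in Ioi (0 : ℝ), (1 - Real.cos x) / x ^ 2 = Real.pi / 2 := by
    rw [integral_eq_lintegral_of_nonneg_ae, lint_cos, ENNReal.toReal_ofReal (by positivity)]
    · exact ae_of_all _ fun x => div_nonneg (by linarith [Real.cos_le_one x]) (by positivity)
    · exact Measurable.aestronglyMeasurable (by fun_prop)
  have h2 := integral_comp_abs (f := fejer)
  simp_rw [fejer_abs] at h2
  rw [h2, setIntegral_congr_fun measurableSet_Ioi (fun x hx => fejer_of_pos hx),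
    integral_const_mul, h1]
  ring

/-- `∫_{-2}^2 φ(tx) h(x) dx = (π/(2t)) h(0) + O(t^{-3/2} ‖h‖_{C^{0,1/2}})` for `1/2`-Hölder `h`. -/
theorem stmt15 :
    ∃ C > (0 : ℝ), ∀ h : ℝ → ℝ, ∀ Mb Hs : ℝ,
      (∀ x ∈ Set.Icc (-2 : ℝ) 2, |h x| ≤ Mb) →
      (∀ x ∈ Set.Icc (-2 : ℝ) 2, ∀ y ∈ Set.Icc (-2 : ℝ) 2,
        |h x - h y| ≤ Hs * |x - y| ^ ((1 : ℝ) / 2)) →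
      ∀ t : ℝ, 0 < t →
        |(∫ x in (-2 : ℝ)..2, fejer (t * x) * h x) - Real.pi / (2 * t) * h 0| ≤
          C * t ^ (-(3 : ℝ) / 2) * (Mb + Hs) := by
  set K := ∫ x, fejer x * |x| ^ ((1 : ℝ) / 2) with hK
  have hK0 : 0 ≤ K := integral_nonneg fun x => mul_nonneg (fejer_nonneg x) (by positivity)
  refine ⟨K + 1, by linarith, fun h Mb Hs hb hh t ht => ?_⟩
  have m0 : (0 : ℝ) ∈ Icc (-2 : ℝ) 2 := by norm_num
  have hMb : 0 ≤ Mb := (abs_nonneg _).trans (hb 0 m0)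
  have hHs : 0 ≤ Hs := by
    have := (abs_nonneg _).trans (hh 1 (by norm_num) 0 m0)
    simpa using this
  have hcont : ContinuousOn h (Icc (-2) 2) := by
    intro x hx
    have hz : Tendsto (fun y => Hs * |y - x| ^ ((1 : ℝ) / 2)) (𝓝[Icc (-2) 2] x) (𝓝 0) := by
      have hc : Continuous (fun y : ℝ => Hs * |y - x| ^ ((1 : ℝ) / 2)) :=
        continuous_const.mul (Continuous.rpow_const (by fun_prop) (fun _ => Or.inr (by norm_num)))
      have := (hc.tendsto x).mono_left (nhdsWithin_le_nhds (s := Icc (-2) 2))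
      simpa using this
    refine tendsto_iff_dist_tendsto_zero.2 (squeeze_zero' (Eventually.of_forall fun _ => dist_nonneg) ?_ hz)
    filter_upwards [self_mem_nhdsWithin] with y hy
    exact hh y hy x hx
  have hg : Integrable (fun x => fejer (t * x)) := fejer_integrable.comp_mul_left' ht.ne'
  have hgv : ∫ x, fejer (t * x) = Real.pi / (2 * t) := by
    rw [Measure.integral_comp_mul_left, fejer_integral, abs_of_pos (by positivity), smul_eq_mul]
    field_simp
  have hgh : IntegrableOn (fun x => fejer (t * x) * h x) (Ioc (-2) 2) := by
    refine Integrable.mul_bdd (c := Mb) hg.integrableOn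
      ((hcont.mono Ioc_subset_Icc_self).aestronglyMeasurable measurableSet_Ioc) ?_
    exact (ae_restrict_iff' measurableSet_Ioc).2 (ae_of_all _ fun x hx => hb x (Ioc_subset_Icc_self hx))
  have hk : Integrable (fun x => fejer (t * x) * |t * x| ^ ((1 : ℝ) / 2)) :=
    fejer_half_integrable.comp_mul_left' ht.ne'
  have hkv : ∫ x, fejer (t * x) * |t * x| ^ ((1 : ℝ) / 2) = t⁻¹ * K := by
    rw [Measure.integral_comp_mul_left (fun x => fejer x * |x| ^ ((1 : ℝ) / 2)),
      abs_of_pos (by positivity), smul_eq_mul]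
  have hkey : ∀ x, fejer (t * x) * |t * x| ^ ((1 : ℝ) / 2) =
      t ^ ((1 : ℝ) / 2) * (fejer (t * x) * |x| ^ ((1 : ℝ) / 2)) := by
    intro x
    rw [abs_mul, abs_of_pos ht, Real.mul_rpow ht.le (abs_nonneg _)]
    ring
  rw [intervalIntegral.integral_of_le (by norm_num), ← hgv, ← integral_mul_const,
    ← integral_indicator measurableSet_Ioc,
    ← integral_sub (hgh.integrable_indicator measurableSet_Ioc) (hg.mul_const _)]
  have hb2 := norm_integral_le_of_norm_le
    (f := fun x => (Ioc (-2 : ℝ) 2).indicator (fun x => fejer (t * x) * h x) x - fejer (t * x) * h 0)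
    (hk.const_mul ((Mb + Hs) * t ^ (-(1 : ℝ) / 2))) (ae_of_all _ fun x => by
      have e : (Mb + Hs) * t ^ (-(1 : ℝ) / 2) * (fejer (t * x) * |t * x| ^ ((1 : ℝ) / 2)) =
          fejer (t * x) * ((Mb + Hs) * |x| ^ ((1 : ℝ) / 2)) := by
        rw [hkey]
        have : t ^ (-(1 : ℝ) / 2) * t ^ ((1 : ℝ) / 2) = 1 := by
          rw [← Real.rpow_add ht]; norm_num
        linear_combination (Mb + Hs) * (fejer (t * x) * |x| ^ ((1 : ℝ) / 2)) * this
      rw [e]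
      have hf := fejer_nonneg (t * x)
      have hr : 0 ≤ |x| ^ ((1 : ℝ) / 2) := by positivity
      by_cases hx : x ∈ Ioc (-2 : ℝ) 2
      · rw [indicator_of_mem hx, ← mul_sub, norm_mul, Real.norm_of_nonneg hf]
        gcongr
        have := hh x (Ioc_subset_Icc_self hx) 0 m0
        rw [sub_zero] at this
        rw [Real.norm_eq_abs]
        nlinarith [mul_nonneg hMb hr]
      · rw [indicator_of_notMem hx, zero_sub, norm_neg, norm_mul, Real.norm_of_nonneg hf]
        gcongr
        have h1 : 1 ≤ |x| := by
          by_contra hc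
          have := abs_lt.1 (not_le.1 hc)
          exact hx ⟨by linarith, by linarith⟩
        have h2 : 1 ≤ |x| ^ ((1 : ℝ) / 2) := Real.one_le_rpow h1 (by norm_num)
        have := hb 0 m0
        rw [Real.norm_eq_abs]
        nlinarith)
  rw [integral_const_mul, hkv] at hb2
  refine hb2.trans ?_
  have e2 : t ^ (-(1 : ℝ) / 2) * t⁻¹ = t ^ (-(3 : ℝ) / 2) := by
    rw [← Real.rpow_neg_one, ← Real.rpow_add ht]; norm_num
  have h3 : 0 ≤ t ^ (-(3 : ℝ) / 2) := by positivity
  calc (Mb + Hs) * t ^ (-(1 : ℝ) / 2) * (t⁻¹ * K) = K * t ^ (-(3 : ℝ) / 2) * (Mb + Hs) := by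
        rw [← e2]; ring
    _ ≤ (K + 1) * t ^ (-(3 : ℝ) / 2) * (Mb + Hs) := by
        gcongr
        linarith
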